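/- For every real number x with 0 < x ≤ 1/18, one has 4·(1 − e^{−x}) / ((1 + 4x)·x) − 3 ≥ 1 − 18x. (The tangent-line inequality used in the soundness analysis of Claim 4.3, Test 2 of the support-size protocol.) -/

import Mathlib

/-- The second-order Taylor polynomial at `0` bounds `e^{-x}` from above for `0 ≤ x`. -/
theorem exp_neg_le_one_sub_add_sq_div_two {x : ℝ} (hx : 0 ≤ x) :
    Real.exp (-x) ≤ 1 - x + x ^ 2 / 2 := by
  rw [Real.exp_neg]
  have hpos : 0 < 1 + x + x ^ 2 / 2 := by positivity
  refine (inv_anti₀ hpos (Real.quadratic_le_exp_of_nonneg hx)).trans ?_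
  rw [inv_le_iff_one_le_mul₀ hpos]
  have : 0 ≤ x ^ 4 := by positivity
  linarith [show (1 - x + x ^ 2 / 2) * (1 + x + x ^ 2 / 2) = 1 + x ^ 4 / 4 by ring]

/-- Tangent-line inequality used in the soundness analysis of Claim 4.3 (Test 2):
`4(1 − e^{−x})/((1+4x)x) − 3 ≥ 1 − 18x` for `0 < x ≤ 1/18`. -/
theorem test2_tangent_line (x : ℝ) (hx0 : 0 < x) (hx1 : x ≤ 1 / 18) :
    4 * (1 - Real.exp (-x)) / ((1 + 4 * x) * x) - 3 ≥ 1 - 18 * x := by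
  have hexp := exp_neg_le_one_sub_add_sq_div_two hx0.le
  have hcube : 0 ≤ x ^ 3 := by positivity
  have h : 4 - 18 * x ≤ 4 * (1 - Real.exp (-x)) / ((1 + 4 * x) * x) := by
    rw [le_div_iff₀ (by positivity)]
    linarith [show (4 - 18 * x) * ((1 + 4 * x) * x) = 4 * x - 2 * x ^ 2 - 72 * x ^ 3 by ring]
  linarith
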